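/- arXiv:1806.06497 — 2 statements merged into one kernel-verified Lean document; each statement's English description precedes it below -/
import Mathlib

section
/- Let Q be an n×n real symmetric positive semidefinite matrix, R an m×m real symmetric positive definite matrix, A an n×n real matrix and B an n×m real matrix. If Y₁ and Y₂ are n×n real symmetric positive semidefinite matrices with Y₁ ⪯ Y₂ in the Loewner order, then Ω(Y₁,Q,R,A,B) ⪯ Ω(Y₂,Q,R,A,B). -/
open Matrix

/-- `Ω(P,Q,R,A,B) = Q + AᵀPA − AᵀPB(R + BᵀPB)⁻¹BᵀPA`. -/
noncomputable def Omega {n m : Type*} [Fintype n] [Fintype m] [DecidableEq m]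
    (P Q : Matrix n n ℝ) (R : Matrix m m ℝ) (A : Matrix n n ℝ) (B : Matrix n m ℝ) :
    Matrix n n ℝ :=
  Q + Aᵀ * P * A - Aᵀ * P * B * (R + Bᵀ * P * B)⁻¹ * (Bᵀ * P * A)

/-- `Ψ(P,R,A,B) = −(R + BᵀPB)⁻¹BᵀPA`. -/
noncomputable def Psi {n m : Type*} [Fintype n] [Fintype m] [DecidableEq m]
    (P : Matrix n n ℝ) (R : Matrix m m ℝ) (A : Matrix n n ℝ) (B : Matrix n m ℝ) :
    Matrix m n ℝ :=
  -((R + Bᵀ * P * B)⁻¹ * (Bᵀ * P * A))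

/-- `Φ(P,K,Q,R,A,B) = Q + KᵀRK + (A+BK)ᵀP(A+BK)`. -/
def Phi {n m : Type*} [Fintype n] [Fintype m]
    (P : Matrix n n ℝ) (K : Matrix m n ℝ) (Q : Matrix n n ℝ) (R : Matrix m m ℝ)
    (A : Matrix n n ℝ) (B : Matrix n m ℝ) : Matrix n n ℝ :=
  Q + Kᵀ * R * K + (A + B * K)ᵀ * P * (A + B * K)


/-- Completing the square in the gain `K`. -/
theorem Phi_eq_Omega_add {n m : Type*} [Fintype n] [Fintype m] [DecidableEq m]
    (P Q : Matrix n n ℝ) (R : Matrix m m ℝ) (A : Matrix n n ℝ) (B : Matrix n m ℝ)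
    (K : Matrix m n ℝ) (hP : P.PosSemidef) (hS : (R + Bᵀ * P * B).PosDef) :
    Phi P K Q R A B = Omega P Q R A B +
      (K - Psi P R A B)ᵀ * (R + Bᵀ * P * B) * (K - Psi P R A B) := by
  have hPt : Pᵀ = P := by simpa using hP.isHermitian.eq
  have hSt : (R + Bᵀ * P * B)ᵀ = R + Bᵀ * P * B := by simpa using hS.isHermitian.eq
  have hdet : IsUnit (R + Bᵀ * P * B).det := (isUnit_iff_isUnit_det _).mp hS.isUnit
  have hPhi : Phi P K Q R A B = Q + Aᵀ * P * A + Kᵀ * (Bᵀ * P * A) + Aᵀ * P * B * K +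
      Kᵀ * (R + Bᵀ * P * B) * K := by
    simp only [Phi, transpose_add, transpose_mul, Matrix.add_mul, Matrix.mul_add,
      Matrix.mul_assoc]
    abel
  have hM : (Bᵀ * P * A)ᵀ = Aᵀ * P * B := by
    simp [transpose_mul, hPt, Matrix.mul_assoc]
  rw [hPhi, Omega, Psi, ← hM]
  generalize R + Bᵀ * P * B = S at *
  generalize Bᵀ * P * A = M at *
  have hcancel : S * (S⁻¹ * M) = M := mul_nonsing_inv_cancel_left _ _ hdet
  have hcancel' (X : Matrix m n ℝ) : S⁻¹ * (S * X) = X :=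
    nonsing_inv_mul_cancel_left _ _ hdet
  simp only [sub_neg_eq_add, transpose_add, transpose_mul, transpose_nonsing_inv, hSt,
    Matrix.add_mul, Matrix.mul_add, Matrix.mul_assoc, hcancel, hcancel']
  abel

/-- The minimum of `Φ` over the gain `K` is `Ω`, attained at `K = Ψ`. -/
theorem Phi_Psi {n m : Type*} [Fintype n] [Fintype m] [DecidableEq m]
    (P Q : Matrix n n ℝ) (R : Matrix m m ℝ) (A : Matrix n n ℝ) (B : Matrix n m ℝ)
    (hP : P.PosSemidef) (hS : (R + Bᵀ * P * B).PosDef) :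
    Phi P (Psi P R A B) Q R A B = Omega P Q R A B := by
  simp [Phi_eq_Omega_add P Q R A B _ hP hS]

theorem posDef_add_transpose_mul_mul {n m : Type*} [Fintype n] [Fintype m]
    {P : Matrix n n ℝ} {R : Matrix m m ℝ} (hR : R.PosDef) (hP : P.PosSemidef)
    (B : Matrix n m ℝ) : (R + Bᵀ * P * B).PosDef := by
  simpa using hR.add_posSemidef (hP.conjTranspose_mul_mul_same B)

theorem stmt2 {n m : ℕ}
    (Q : Matrix (Fin n) (Fin n) ℝ) (R : Matrix (Fin m) (Fin m) ℝ)
    (A : Matrix (Fin n) (Fin n) ℝ) (B : Matrix (Fin n) (Fin m) ℝ)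
    (hQ : Q.PosSemidef) (hR : R.PosDef)
    (Y₁ Y₂ : Matrix (Fin n) (Fin n) ℝ)
    (hY₁ : Y₁.PosSemidef) (hY₂ : Y₂.PosSemidef)
    (hle : (Y₂ - Y₁).PosSemidef) :
    (Omega Y₂ Q R A B - Omega Y₁ Q R A B).PosSemidef := by
  have hS₁ := posDef_add_transpose_mul_mul hR hY₁ B
  have hS₂ := posDef_add_transpose_mul_mul hR hY₂ B
  rw [← Phi_Psi Y₂ Q R A B hY₂ hS₂]
  set K := Psi Y₂ R A B
  have hdiff : Phi Y₂ K Q R A B - Omega Y₁ Q R A B =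
      (A + B * K)ᵀ * (Y₂ - Y₁) * (A + B * K) +
        (K - Psi Y₁ R A B)ᵀ * (R + Bᵀ * Y₁ * B) * (K - Psi Y₁ R A B) := by
    rw [← sub_eq_iff_eq_add'.mpr (Phi_eq_Omega_add Y₁ Q R A B K hY₁ hS₁), Phi, Phi,
      Matrix.mul_sub, Matrix.sub_mul]
    abel
  rw [hdiff]
  simpa using (hle.conjTranspose_mul_mul_same (A + B * K)).add
    (hS₁.posSemidef.conjTranspose_mul_mul_same (K - Psi Y₁ R A B))
end

section
/- If the N-plant coupled Riccati iterates Y_k^0, Y_k^1, …, Y_k^N do not all converge as k → ∞, then limsup over T → ∞ of (1/(T+1))·Σ_{k=0}^T Σ_{n=1}^N tr((1−p^n)[Y_k^0]_{n,n} + p^n Y_k^n) = ∞. -/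
open Matrix Filter
open scoped Topology

/-- Spectral radius of a real square matrix. -/
noncomputable def specRad {ι : Type*} [Fintype ι] [DecidableEq ι]
    (M : Matrix ι ι ℝ) : ℝ :=
  (spectralRadius ℂ (M.map Complex.ofReal)).toReal

/-- The aggregate input matrix `B` of the `N`-plant DNCS: the `n`-th block row has
`B^{n0}` in block column `0`, `B^{nn}` in block column `n`, and zeros elsewhere. -/
def Bagg {N m₀ : ℕ} {d m : Fin N → ℕ}
    (Bn0 : ∀ i, Matrix (Fin (d i)) (Fin m₀) ℝ)
    (Bnn : ∀ i, Matrix (Fin (d i)) (Fin (m i)) ℝ) :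
    Matrix (Σ i, Fin (d i)) (Fin m₀ ⊕ (Σ i, Fin (m i))) ℝ :=
  fun a c =>
    match c with
    | Sum.inl j => Bn0 a.1 a.2 j
    | Sum.inr b => if h : b.1 = a.1 then Bnn a.1 a.2 (h ▸ b.2) else 0

/-- The `(n,n)` diagonal block of a `d×d` matrix (blocks indexed by the plants). -/
def blockGet {N : ℕ} {d : Fin N → ℕ}
    (P : Matrix (Σ i, Fin (d i)) (Σ i, Fin (d i)) ℝ) (i : Fin N) :
    Matrix (Fin (d i)) (Fin (d i)) ℝ :=
  P.submatrix (fun x => ⟨i, x⟩) (fun x => ⟨i, x⟩)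

/-- The `(n,n)` diagonal block of `R` corresponding to local controller `n`. -/
def Rblock {N m₀ : ℕ} {m : Fin N → ℕ}
    (R : Matrix (Fin m₀ ⊕ (Σ i, Fin (m i))) (Fin m₀ ⊕ (Σ i, Fin (m i))) ℝ)
    (i : Fin N) : Matrix (Fin (m i)) (Fin (m i)) ℝ :=
  R.submatrix (fun j => Sum.inr ⟨i, j⟩) (fun j => Sum.inr ⟨i, j⟩)

/-- The `N`-plant coupled Riccati iterates started from zero:
`Y_0^0 = 0`, `Y_0^n = 0`, `Y_{k+1}^0 = Ω(Y_k^0, Q, R, A, B)`,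
`Y_{k+1}^n = Ω((1−p^n)[Y_k^0]_{n,n} + p^n Y_k^n, Q^{nn}, R^{nn}, A^{nn}, B^{nn})`. -/
noncomputable def YN {N m₀ : ℕ} {d m : Fin N → ℕ}
    (Ann : ∀ i, Matrix (Fin (d i)) (Fin (d i)) ℝ)
    (Bnn : ∀ i, Matrix (Fin (d i)) (Fin (m i)) ℝ)
    (A : Matrix (Σ i, Fin (d i)) (Σ i, Fin (d i)) ℝ)
    (B : Matrix (Σ i, Fin (d i)) (Fin m₀ ⊕ (Σ i, Fin (m i))) ℝ)
    (Q : Matrix (Σ i, Fin (d i)) (Σ i, Fin (d i)) ℝ)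
    (R : Matrix (Fin m₀ ⊕ (Σ i, Fin (m i))) (Fin m₀ ⊕ (Σ i, Fin (m i))) ℝ)
    (p : Fin N → ℝ) :
    ℕ → Matrix (Σ i, Fin (d i)) (Σ i, Fin (d i)) ℝ ×
      (∀ i : Fin N, Matrix (Fin (d i)) (Fin (d i)) ℝ)
  | 0 => (0, fun _ => 0)
  | k + 1 =>
      let Y := YN Ann Bnn A B Q R p k
      (Omega Y.1 Q R A B,
       fun i => Omega ((1 - p i) • blockGet Y.1 i + p i • Y.2 i)
         (blockGet Q i) (Rblock R i) (Ann i) (Bnn i))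

namespace Riccati

variable {n m l : Type*} [Fintype n] [Fintype m]

theorem transpose_mul_mul_posSemidef [Fintype l] {P : Matrix n n ℝ} (hP : P.PosSemidef) (E : Matrix n l ℝ) :
    (Eᵀ * P * E).PosSemidef := by
  simpa [conjTranspose_eq_transpose_of_trivial] using hP.conjTranspose_mul_mul_same E

theorem gram_posDef {P : Matrix n n ℝ} {R : Matrix m m ℝ} (hP : P.PosSemidef) (hR : R.PosDef)
    (B : Matrix n m ℝ) : (R + Bᵀ * P * B).PosDef :=
  hR.add_posSemidef (transpose_mul_mul_posSemidef hP B)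

/-- Completion of squares for the Riccati operator, restricted along `E`. -/
theorem omega_add_square [DecidableEq m] {P : Matrix n n ℝ} {R : Matrix m m ℝ}
    (hP : P.PosSemidef) (hR : R.PosDef) (Q A : Matrix n n ℝ) (B : Matrix n m ℝ)
    (E : Matrix n l ℝ) (K : Matrix m l ℝ) :
    Eᵀ * Q * E + Kᵀ * R * K + (A * E + B * K)ᵀ * P * (A * E + B * K) =
      Eᵀ * Omega P Q R A B * E +
        (K + (R + Bᵀ * P * B)⁻¹ * (Bᵀ * P * A * E))ᵀ * (R + Bᵀ * P * B) *
          (K + (R + Bᵀ * P * B)⁻¹ * (Bᵀ * P * A * E)) := by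
  have hS := gram_posDef hP hR B
  have hPt : Pᵀ = P := by simpa [conjTranspose_eq_transpose_of_trivial] using hP.isHermitian.eq
  have hSt : (R + Bᵀ * P * B)ᵀ = R + Bᵀ * P * B := by
    simpa only [conjTranspose_eq_transpose_of_trivial] using hS.isHermitian.eq
  have hu : IsUnit (R + Bᵀ * P * B).det := hS.det_pos.ne'.isUnit
  have hRS : Kᵀ * R * K = Kᵀ * (R + Bᵀ * P * B) * K - Kᵀ * Bᵀ * P * B * K := by
    simp only [Matrix.mul_add, Matrix.add_mul, Matrix.mul_assoc]; abel
  rw [hRS]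
  unfold Omega
  generalize R + Bᵀ * P * B = S at *
  have h1 : ∀ X : Matrix m l ℝ, S * (S⁻¹ * X) = X := fun X => by
    rw [← Matrix.mul_assoc, Matrix.mul_nonsing_inv _ hu, Matrix.one_mul]
  have h2 : ∀ X : Matrix m l ℝ, S⁻¹ * (S * X) = X := fun X => by
    rw [← Matrix.mul_assoc, Matrix.nonsing_inv_mul _ hu, Matrix.one_mul]
  simp only [transpose_add, transpose_mul, Matrix.transpose_nonsing_inv, hSt, hPt,
    transpose_transpose, Matrix.mul_add, Matrix.add_mul, Matrix.mul_sub, Matrix.sub_mul,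
    Matrix.mul_assoc, h1, h2]
  abel

/-- The Riccati operator is bounded above by the cost of any feedback. -/
theorem omega_le_feedback [DecidableEq m] [Fintype l] {P : Matrix n n ℝ} {R : Matrix m m ℝ}
    (hP : P.PosSemidef) (hR : R.PosDef) (Q A : Matrix n n ℝ) (B : Matrix n m ℝ)
    (E : Matrix n l ℝ) (K : Matrix m l ℝ) :
    (Eᵀ * Q * E + Kᵀ * R * K + (A * E + B * K)ᵀ * P * (A * E + B * K) -
      Eᵀ * Omega P Q R A B * E).PosSemidef := by
  rw [omega_add_square hP hR, add_sub_cancel_left]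
  exact transpose_mul_mul_posSemidef (gram_posDef hP hR B).posSemidef _

/-- Some feedback attains the value of the Riccati operator. -/
theorem exists_feedback_eq_omega [DecidableEq m] {P : Matrix n n ℝ} {R : Matrix m m ℝ}
    (hP : P.PosSemidef) (hR : R.PosDef) (Q A : Matrix n n ℝ) (B : Matrix n m ℝ) :
    ∃ K : Matrix m n ℝ,
      Omega P Q R A B = Q + Kᵀ * R * K + (A + B * K)ᵀ * P * (A + B * K) := by
  classical
  refine ⟨-((R + Bᵀ * P * B)⁻¹ * (Bᵀ * P * A)), ?_⟩
  have h := omega_add_square hP hR Q A B (1 : Matrix n n ℝ)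
    (-((R + Bᵀ * P * B)⁻¹ * (Bᵀ * P * A)))
  simp only [Matrix.mul_one, Matrix.one_mul, transpose_one, neg_add_cancel, Matrix.mul_zero,
    add_zero] at h
  exact h.symm

theorem omega_posSemidef [DecidableEq m] {P Q : Matrix n n ℝ} {R : Matrix m m ℝ}
    (hP : P.PosSemidef) (hQ : Q.PosSemidef) (hR : R.PosDef)
    (A : Matrix n n ℝ) (B : Matrix n m ℝ) : (Omega P Q R A B).PosSemidef := by
  obtain ⟨K, hK⟩ := exists_feedback_eq_omega hP hR Q A B
  rw [hK]
  exact (hQ.add (transpose_mul_mul_posSemidef hR.posSemidef K)).add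
    (transpose_mul_mul_posSemidef hP _)

/-- Compressing the Riccati operator along `E` is dominated by the Riccati operator of the
subsystem embedded by `E` and `F`, at any larger cost-to-go. -/
theorem omega_compress_le {n' m' : Type*} [DecidableEq m] [Fintype n'] [Fintype m'] [DecidableEq m']
    {P : Matrix n n ℝ} {P' : Matrix n' n' ℝ} {R : Matrix m m ℝ} {R' : Matrix m' m' ℝ}
    {A : Matrix n n ℝ} {A' : Matrix n' n' ℝ} {B : Matrix n m ℝ} {B' : Matrix n' m' ℝ}
    {E : Matrix n n' ℝ} {F : Matrix m m' ℝ}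
    (hP : P.PosSemidef) (hR : R.PosDef) (hP' : P'.PosSemidef) (hR' : R'.PosDef)
    (Q : Matrix n n ℝ) (hRF : Fᵀ * R * F = R') (hA : A * E = E * A') (hB : B * F = E * B')
    (hle : (P' - Eᵀ * P * E).PosSemidef) :
    (Omega P' (Eᵀ * Q * E) R' A' B' - Eᵀ * Omega P Q R A B * E).PosSemidef := by
  obtain ⟨K, hK⟩ := exists_feedback_eq_omega hP' hR' (Eᵀ * Q * E) A' B'
  have h1 := omega_le_feedback hP hR Q A B E (F * K)
  have h2 := transpose_mul_mul_posSemidef hle (A' + B' * K)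
  convert h1.add h2 using 1
  rw [hK, ← hRF, hA, ← Matrix.mul_assoc B, hB, Matrix.mul_assoc E, ← Matrix.mul_add]
  simp only [transpose_mul, Matrix.mul_sub, Matrix.sub_mul, Matrix.mul_assoc]
  abel

theorem omega_mono [DecidableEq m] {P P' : Matrix n n ℝ} {R : Matrix m m ℝ}
    (hP : P.PosSemidef) (hP' : P'.PosSemidef) (hR : R.PosDef) (Q A : Matrix n n ℝ)
    (B : Matrix n m ℝ) (hle : (P' - P).PosSemidef) :
    (Omega P' Q R A B - Omega P Q R A B).PosSemidef := by
  classical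
  simpa using omega_compress_le (E := (1 : Matrix n n ℝ)) (F := (1 : Matrix m m ℝ)) (A := A) (A' := A) (B := B) (B' := B)
    hP hR hP' hR Q (by simp) (by simp) (by simp) (by simpa using hle)

theorem omega_le_zero_feedback [DecidableEq m] {P : Matrix n n ℝ} {R : Matrix m m ℝ}
    (hP : P.PosSemidef) (hR : R.PosDef) (Q A : Matrix n n ℝ) (B : Matrix n m ℝ) :
    (Q + Aᵀ * P * A - Omega P Q R A B).PosSemidef := by
  classical
  simpa using omega_le_feedback hP hR Q A B (1 : Matrix n n ℝ) 0

theorem abs_apply_le_trace {M : Matrix n n ℝ} (hM : M.PosSemidef) (i j : n) :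
    |M i j| ≤ M.trace := by
  classical
  have hd : ∀ i, M i i ≤ M.trace := fun i =>
    Finset.single_le_sum (f := fun i => M i i) (fun i _ => hM.diag_nonneg) (Finset.mem_univ i)
  have hs : M j i = M i j := by simpa using hM.isHermitian.apply i j
  have h1 := hM.dotProduct_mulVec_nonneg (Pi.single i 1 + Pi.single j 1)
  have h2 := hM.dotProduct_mulVec_nonneg (Pi.single i 1 - Pi.single j 1)
  simp [mulVec_add, mulVec_sub, hs] at h1 h2
  have := hd i
  have := hd j
  rw [abs_le]
  constructor <;> linarith

/-- A Loewner-monotone sequence of positive semidefinite matrices with bounded trace converges. -/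
theorem exists_tendsto_of_trace_bounded {M : ℕ → Matrix n n ℝ} (hM : ∀ k, (M k).PosSemidef)
    (hmono : ∀ k, (M (k + 1) - M k).PosSemidef) {C : ℝ} (hC : ∀ k, (M k).trace ≤ C) :
    ∃ L, Tendsto M atTop (𝓝 L) := by
  have htr : Monotone fun k => (M k).trace := monotone_nat_of_le_succ fun k => by
    have := (hmono k).trace_nonneg
    rw [trace_sub] at this
    linarith
  have hbt : BddAbove (Set.range fun k => (M k).trace) := ⟨C, by rintro _ ⟨k, rfl⟩; exact hC k⟩
  have key : ∀ i j, ∃ a, Tendsto (fun k => M k i j) atTop (𝓝 a) := by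
    intro i j
    have hm : Monotone fun k => M k i j + (M k).trace := monotone_nat_of_le_succ fun k => by
      have := neg_le_of_abs_le (abs_apply_le_trace (hmono k) i j)
      rw [trace_sub, Matrix.sub_apply] at this
      linarith
    have hb : BddAbove (Set.range fun k => M k i j + (M k).trace) := ⟨C + C, by
      rintro _ ⟨k, rfl⟩
      exact add_le_add ((le_of_abs_le (abs_apply_le_trace (hM k) i j)).trans (hC k)) (hC k)⟩
    exact ⟨_, by simpa using (tendsto_atTop_ciSup hm hb).sub (tendsto_atTop_ciSup htr hbt)⟩
  choose L hL using key
  exact ⟨L, tendsto_pi_nhds.2 fun i => tendsto_pi_nhds.2 fun j => hL i j⟩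

end Riccati

theorem tendsto_cesaro_atTop {s : ℕ → ℝ} (h0 : ∀ k, 0 ≤ s k) (hs : Tendsto s atTop atTop) :
    Tendsto (fun T : ℕ => ((1 : ℝ) / (T + 1)) * ∑ k ∈ Finset.range (T + 1), s k)
      atTop atTop := by
  refine tendsto_atTop.2 fun M => ?_
  obtain ⟨K, hK⟩ := eventually_atTop.1 (tendsto_atTop.1 hs (2 * |M|))
  filter_upwards [eventually_ge_atTop (2 * K)] with T hT
  have h1 : ∑ k ∈ Finset.Ico K (T + 1), (2 * |M|) ≤ ∑ k ∈ Finset.range (T + 1), s k := by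
    refine (Finset.sum_le_sum fun k hk => hK k (Finset.mem_Ico.1 hk).1).trans ?_
    refine Finset.sum_le_sum_of_subset_of_nonneg (fun k hk => ?_) fun k _ _ => h0 k
    exact Finset.mem_range.2 (Finset.mem_Ico.1 hk).2
  rw [Finset.sum_const, Nat.card_Ico, nsmul_eq_mul, Nat.cast_sub (by omega)] at h1
  have h2 : (2 * K : ℝ) ≤ T := by exact_mod_cast hT
  have h3 : (0 : ℝ) < T + 1 := by positivity
  rw [one_div, inv_mul_eq_div, le_div_iff₀ h3]
  push_cast at h1
  nlinarith [le_abs_self M, abs_nonneg M]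

section Plants

variable {N : ℕ} {d : Fin N → ℕ}

/-- The inclusion of the `i`-th block as a matrix. -/
def blockIncl (d : Fin N → ℕ) (i : Fin N) : Matrix (Σ i, Fin (d i)) (Fin (d i)) ℝ :=
  (1 : Matrix (Σ i, Fin (d i)) (Σ i, Fin (d i)) ℝ).submatrix id fun x => ⟨i, x⟩

/-- The inclusion of the `i`-th local input block as a matrix. -/
def inputIncl (m₀ : ℕ) (m : Fin N → ℕ) (i : Fin N) :
    Matrix (Fin m₀ ⊕ (Σ i, Fin (m i))) (Fin (m i)) ℝ :=
  (1 : Matrix (Fin m₀ ⊕ (Σ i, Fin (m i))) (Fin m₀ ⊕ (Σ i, Fin (m i))) ℝ).submatrix id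
    fun j => Sum.inr ⟨i, j⟩

theorem transpose_mul_mul_one_submatrix {n l : Type*} [Fintype n] [DecidableEq n]
    (P : Matrix n n ℝ) (f : l → n) :
    ((1 : Matrix n n ℝ).submatrix id f)ᵀ * P * (1 : Matrix n n ℝ).submatrix id f =
      P.submatrix f f := by
  ext a b
  simp [Matrix.mul_apply, Matrix.one_apply]

theorem blockGet_eq (P : Matrix (Σ i, Fin (d i)) (Σ i, Fin (d i)) ℝ) (i : Fin N) :
    blockGet P i = (blockIncl d i)ᵀ * P * blockIncl d i :=
  (transpose_mul_mul_one_submatrix P _).symm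

theorem blockDiagonal'_mul_blockIncl (Ann : ∀ i, Matrix (Fin (d i)) (Fin (d i)) ℝ) (i : Fin N) :
    blockDiagonal' Ann * blockIncl d i = blockIncl d i * Ann i := by
  ext ⟨j, x⟩ y
  rcases eq_or_ne j i with rfl | h
  · simp [blockIncl, Matrix.mul_apply, Matrix.one_apply]
  · simp [blockIncl, Matrix.mul_apply, Matrix.one_apply, blockDiagonal'_apply, h]

theorem Bagg_mul_inputIncl {m₀ : ℕ} {m : Fin N → ℕ}
    (Bn0 : ∀ i, Matrix (Fin (d i)) (Fin m₀) ℝ) (Bnn : ∀ i, Matrix (Fin (d i)) (Fin (m i)) ℝ)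
    (i : Fin N) :
    Bagg Bn0 Bnn * inputIncl m₀ m i = blockIncl d i * Bnn i := by
  ext ⟨j, x⟩ y
  rcases eq_or_ne j i with rfl | h
  · simp [blockIncl, inputIncl, Bagg, Matrix.mul_apply, Matrix.one_apply]
  · simp [blockIncl, inputIncl, Bagg, Matrix.mul_apply, Matrix.one_apply, h, h.symm]

theorem sum_trace_blockGet (P : Matrix (Σ i, Fin (d i)) (Σ i, Fin (d i)) ℝ) :
    ∑ i, (blockGet P i).trace = P.trace := by
  simp [Matrix.trace, blockGet, Fintype.sum_sigma]

end Plants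

/-- If the `N`-plant coupled Riccati iterates do not all converge, the Cesàro averages
of the traces diverge to `∞`. -/
theorem stmt18 {N m₀ : ℕ} {d m : Fin N → ℕ}
    (Ann : ∀ i, Matrix (Fin (d i)) (Fin (d i)) ℝ)
    (Bnn : ∀ i, Matrix (Fin (d i)) (Fin (m i)) ℝ)
    (Bn0 : ∀ i, Matrix (Fin (d i)) (Fin m₀) ℝ)
    (A : Matrix (Σ i, Fin (d i)) (Σ i, Fin (d i)) ℝ)
    (hA : A = Matrix.blockDiagonal' Ann)
    (B : Matrix (Σ i, Fin (d i)) (Fin m₀ ⊕ (Σ i, Fin (m i))) ℝ)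
    (hB : B = Bagg Bn0 Bnn)
    (Q : Matrix (Σ i, Fin (d i)) (Σ i, Fin (d i)) ℝ) (hQ : Q.PosSemidef)
    (R : Matrix (Fin m₀ ⊕ (Σ i, Fin (m i))) (Fin m₀ ⊕ (Σ i, Fin (m i))) ℝ)
    (hR : R.PosDef)
    (p : Fin N → ℝ) (hp : ∀ i, 0 ≤ p i ∧ p i ≤ 1)
    (hnconv : ¬ ((∃ P0, Tendsto (fun k => (YN Ann Bnn A B Q R p k).1) atTop (𝓝 P0)) ∧
        ∀ i : Fin N, ∃ Pi, Tendsto (fun k => (YN Ann Bnn A B Q R p k).2 i) atTop (𝓝 Pi))) :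
    Filter.limsup
      (fun T : ℕ =>
        (((1 : ℝ) / (T + 1)) * ∑ k ∈ Finset.range (T + 1), ∑ i : Fin N,
          Matrix.trace ((1 - p i) • blockGet (YN Ann Bnn A B Q R p k).1 i +
            p i • (YN Ann Bnn A B Q R p k).2 i) : ℝ) |>.toEReal)
      atTop = ⊤ := by
  set Y := YN Ann Bnn A B Q R p with hY
  set W : ∀ k, ∀ i : Fin N, Matrix (Fin (d i)) (Fin (d i)) ℝ :=
    fun k i => (1 - p i) • blockGet (Y k).1 i + p i • (Y k).2 i with hW
  have hY0 : ∀ k, (Y (k + 1)).1 = Omega (Y k).1 Q R A B := fun _ => rfl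
  have hYi : ∀ k i, (Y (k + 1)).2 i =
      Omega (W k i) (blockGet Q i) (Rblock R i) (Ann i) (Bnn i) := fun _ _ => rfl
  have hblock : ∀ {P : Matrix (Σ i, Fin (d i)) (Σ i, Fin (d i)) ℝ} (i : Fin N),
      P.PosSemidef → (blockGet P i).PosSemidef := fun i hP => hP.submatrix _
  have hRi : ∀ i, (Rblock R i).PosDef := fun i =>
    hR.submatrix (Sum.inr_injective.comp sigma_mk_injective)
  have hmix : ∀ {l : ℕ} (i : Fin N) {X Z : Matrix (Fin l) (Fin l) ℝ},
      X.PosSemidef → Z.PosSemidef → ((1 - p i) • X + p i • Z).PosSemidef := fun i _ _ hX hZ =>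
    (hX.smul (sub_nonneg.2 (hp i).2)).add (hZ.smul (hp i).1)
  have hpsd : ∀ k, (Y k).1.PosSemidef ∧ ∀ i, ((Y k).2 i).PosSemidef := by
    intro k
    induction k with
    | zero => exact ⟨PosSemidef.zero, fun _ => PosSemidef.zero⟩
    | succ k ih =>
      exact ⟨Riccati.omega_posSemidef ih.1 hQ hR A B, fun i => Riccati.omega_posSemidef
        (hmix i (hblock i ih.1) (ih.2 i)) (hblock i hQ) (hRi i) _ _⟩
  have hWpsd : ∀ k i, (W k i).PosSemidef := fun k i =>
    hmix i (hblock i (hpsd k).1) ((hpsd k).2 i)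
  have hWstep : ∀ k i, ((Y (k + 1)).1 - (Y k).1).PosSemidef →
      ((Y (k + 1)).2 i - (Y k).2 i).PosSemidef → (W (k + 1) i - W k i).PosSemidef := by
    intro k i h0 hi
    convert hmix i (hblock i h0) hi using 1
    ext a b
    simp [hW, blockGet]
    ring
  have hmono : ∀ k, ((Y (k + 1)).1 - (Y k).1).PosSemidef ∧
      ∀ i, ((Y (k + 1)).2 i - (Y k).2 i).PosSemidef := by
    intro k
    induction k with
    | zero =>
      refine ⟨?_, fun i => ?_⟩
      · have : (Y 0).1 = 0 := rfl
        simpa [this] using (hpsd 1).1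
      · have : (Y 0).2 i = 0 := rfl
        simpa [this] using (hpsd 1).2 i
    | succ k ih =>
      refine ⟨Riccati.omega_mono (hpsd k).1 (hpsd (k + 1)).1 hR Q A B ih.1, fun i => ?_⟩
      rw [hYi, hYi k]
      exact Riccati.omega_mono (hWpsd k i) (hWpsd (k + 1) i) (hRi i) _ _ _
        (hWstep k i ih.1 (ih.2 i))
  have hWof : ∀ k i, ((Y k).2 i - blockGet (Y k).1 i).PosSemidef →
      (W k i - blockGet (Y k).1 i).PosSemidef := by
    intro k i h
    convert h.smul (hp i).1 using 1
    ext a b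
    simp [hW]
    ring
  have hdom : ∀ k i, ((Y k).2 i - blockGet (Y k).1 i).PosSemidef := by
    intro k i
    induction k with
    | zero =>
      have : (Y 0).2 i - blockGet (Y 0).1 i = 0 := sub_self 0
      rw [this]
      exact PosSemidef.zero
    | succ k ih =>
      rw [hYi, hY0, blockGet_eq, blockGet_eq]
      refine Riccati.omega_compress_le (F := inputIncl m₀ m i) (hpsd k).1 hR (hWpsd k i) (hRi i) Q
        (transpose_mul_mul_one_submatrix R _) ?_ ?_ ?_
      · rw [hA, blockDiagonal'_mul_blockIncl]
      · rw [hB, Bagg_mul_inputIncl]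
      · rw [← blockGet_eq]
        exact hWof k i ih
  have htmono : Monotone fun k => ∑ i, (W k i).trace := monotone_nat_of_le_succ fun k =>
    Finset.sum_le_sum fun i _ => by
      have := (hWstep k i (hmono k).1 ((hmono k).2 i)).trace_nonneg
      rw [trace_sub] at this
      linarith
  have hunb : ¬ ∃ C, ∀ k, ∑ i, (W k i).trace ≤ C := by
    rintro ⟨C, hC⟩
    refine hnconv ⟨Riccati.exists_tendsto_of_trace_bounded (fun k => (hpsd k).1)
      (fun k => (hmono k).1) (C := C) fun k => ?_, fun i => ?_⟩
    · refine le_trans ?_ (hC k)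
      rw [← sum_trace_blockGet]
      refine Finset.sum_le_sum fun i _ => ?_
      have := (hWof k i (hdom k i)).trace_nonneg
      rw [trace_sub] at this
      linarith
    · obtain ⟨L, hL⟩ := Riccati.exists_tendsto_of_trace_bounded (fun k => hWpsd k i)
        (fun k => hWstep k i (hmono k).1 ((hmono k).2 i)) (C := C) fun k =>
          (Finset.single_le_sum (f := fun i => (W k i).trace)
            (fun i _ => (hWpsd k i).trace_nonneg) (Finset.mem_univ i)).trans (hC k)
      have hcont : Continuous fun X : Matrix (Fin (d i)) (Fin (d i)) ℝ =>
          (blockGet Q i + (Ann i)ᵀ * X * Ann i).trace := by fun_prop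
      obtain ⟨D, hD⟩ := ((hcont.tendsto L).comp hL).bddAbove_range
      refine Riccati.exists_tendsto_of_trace_bounded (fun k => (hpsd k).2 i)
        (fun k => (hmono k).2 i) (C := D) fun k => ?_
      have h1 := ((hmono k).2 i).trace_nonneg
      have h2 := (Riccati.omega_le_zero_feedback (hWpsd k i) (hRi i) (blockGet Q i) (Ann i)
        (Bnn i)).trace_nonneg
      have h3 := hD ⟨k, rfl⟩
      rw [trace_sub] at h1 h2
      rw [hYi] at h1
      simp only [Function.comp_apply] at h3
      linarith
  have htop : Tendsto (fun k => ∑ i, (W k i).trace) atTop atTop :=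
    tendsto_atTop_atTop_of_monotone htmono fun C => by
      by_contra! h
      exact hunb ⟨C, fun k => (h k).le⟩
  exact (EReal.tendsto_coe_nhds_top_iff.2 (tendsto_cesaro_atTop
    (fun k => Finset.sum_nonneg fun i _ => (hWpsd k i).trace_nonneg) htop)).limsup_eq
end
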